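/- arXiv:2004.12423 — 4 statements merged into one kernel-verified Lean document; each statement's English description precedes it below -/
import Mathlib

section
/- Let (X,F) be a symmetric n-ary band. Then for every x₁,…,xₙ ∈ X, writing z = F(x₁,…,xₙ), one has F(x₁,…,xₙ) = F(ℓ_z(x₁),…,ℓ_z(xₙ)). -/
namespace NaryBand

variable {X : Type*}

/-- Replace the window of length `n` starting at position `i` (0-based) of the
`(2*n-1)`-tuple `x` by the value of `F` on that window. -/
def contract {n : ℕ} (F : (Fin n → X) → X) (i : ℕ) (hn : 2 ≤ n) (hi : i ≤ n - 1)
    (x : Fin (2 * n - 1) → X) : Fin n → X :=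
  fun j =>
    if _h1 : (j : ℕ) < i then x ⟨(j : ℕ), by have := j.isLt; omega⟩
    else if _h2 : (j : ℕ) = i then
      F (fun k => x ⟨i + (k : ℕ), by have := k.isLt; omega⟩)
    else x ⟨(j : ℕ) + n - 1, by have := j.isLt; omega⟩

/-- `F` is an associative `n`-ary operation. -/
def NAssoc {n : ℕ} (hn : 2 ≤ n) (F : (Fin n → X) → X) : Prop :=
  ∀ (i : ℕ) (hi : i + 1 ≤ n - 1) (x : Fin (2 * n - 1) → X),
    F (contract F i hn (by omega) x) = F (contract F (i + 1) hn (by omega) x)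

/-- `F` is a symmetric `n`-ary operation. -/
def NSym {n : ℕ} (F : (Fin n → X) → X) : Prop :=
  ∀ (σ : Equiv.Perm (Fin n)) (x : Fin n → X), F (x ∘ σ) = F x

/-- `F` is an idempotent `n`-ary operation. -/
def NIdem {n : ℕ} (F : (Fin n → X) → X) : Prop :=
  ∀ x : X, F (fun _ => x) = x

/-- The associated binary operation `B(x,y) = F(x,…,x,y)` (with `n-1` copies of `x`). -/
def assocB {n : ℕ} (F : (Fin n → X) → X) (x y : X) : X :=
  F (fun j => if (j : ℕ) < n - 1 then x else y)

/-- The map `ℓ_x : y ↦ B(x,y)`. -/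
def ell {n : ℕ} (F : (Fin n → X) → X) (x : X) : X → X :=
  fun y => assocB F x y

/-- The `n`-ary extension `G^{n-1}(x₁,…,xₙ) = G(x₁, G(x₂, …, G(x_{n-1}, xₙ)…))`
of a binary operation `G`. -/
def nExt {n : ℕ} (hn : 1 ≤ n) (G : X → X → X) (x : Fin n → X) : X :=
  (List.ofFn (fun i : Fin (n - 1) => x ⟨(i : ℕ), by have := i.isLt; omega⟩)).foldr G
    (x ⟨n - 1, by omega⟩)

/-- The relation `σ`: `x σ y` iff `B(x,y) = y` and `B(y,x) = x`. -/
def sigmaRel {n : ℕ} (F : (Fin n → X) → X) (x y : X) : Prop :=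
  assocB F x y = y ∧ assocB F y x = x

/-- `(A, mul)` is an abelian group with identity `e` and inversion `inv`. -/
def IsAbelianGroup {A : Type*} (mul : A → A → A) (e : A) (inv : A → A) : Prop :=
  (∀ a b c, mul (mul a b) c = mul a (mul b c)) ∧
  (∀ a b, mul a b = mul b a) ∧
  (∀ a, mul e a = a) ∧
  (∀ a, mul (inv a) a = e)

/-- `k`-fold product `a * ⋯ * a` with respect to `mul` (with `powMul mul e 0 a = e`). -/
def powMul {A : Type*} (mul : A → A → A) (e : A) : ℕ → A → A
  | 0, _ => e
  | k + 1, a => mul a (powMul mul e k a)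

end NaryBand

open NaryBand

namespace NaryBand

open Function

/-- Exchanging the first entry of an inner window with the entry right after the window. -/
lemma exchange_zero_one {X : Type*} {m : ℕ} {F : (Fin (m + 2) → X) → X} {hn : 2 ≤ m + 2}
    (hA : NAssoc hn F) (hS : NSym F) (x y : Fin (m + 2) → X) (b : X) :
    F (update (update y 0 (F x)) 1 b) =
      F (update (update y 0 (F (update x 0 b))) 1 (x 0)) := by
  let z : Fin (2 * (m + 2) - 1) → X := fun t =>
    if h : (t : ℕ) < m + 2 then x ⟨t, h⟩
    else if (t : ℕ) = m + 2 then b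
    else y ⟨(t : ℕ) - (m + 1), by have := t.isLt; omega⟩
  have hleft : contract F 0 hn (by omega) z = update (update y 0 (F x)) 1 b := by
    funext ⟨t, ht⟩
    rcases t with _ | _ | t
    · simp [contract, z]
    · simp [contract, z]
    · have h1 : ¬ (t + 1 + 1 + (m + 1) < m + 2) := by omega
      have h2 : ¬ (t + 1 + 1 + (m + 1) = m + 2) := by omega
      simp [contract, z, Fin.ext_iff, h1, h2]
  have hinner : F (fun k : Fin (m + 2) => z ⟨1 + (k : ℕ), by have := k.isLt; omega⟩) =
      F (update x 0 b) := by
    rw [← hS (finRotate (m + 2)) (update x 0 b)]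
    congr 1
    funext k
    rcases Fin.eq_castSucc_or_eq_last k with ⟨k, rfl⟩ | rfl
    · have hk : 1 + (k : ℕ) < m + 2 := by omega
      have hk' : (⟨1 + (k : ℕ), hk⟩ : Fin (m + 2)) = k.succ := by ext; simp [add_comm]
      simp [z, hk, hk']
    · have h2 : 1 + (m + 1) = m + 2 := by omega
      simp [z, h2]
  have hright : contract F 1 hn (by omega) z ∘ Equiv.swap 0 1 =
      update (update y 0 (F (update x 0 b))) 1 (x 0) := by
    funext ⟨t, ht⟩
    rcases t with _ | _ | t
    · have : (⟨0, ht⟩ : Fin (m + 2)) = 0 := rfl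
      rw [this, comp_apply, Equiv.swap_apply_left, ← hinner]
      simp [contract]
    · have : (⟨0 + 1, ht⟩ : Fin (m + 2)) = 1 := by ext; simp
      rw [this, comp_apply, Equiv.swap_apply_right]
      simp [contract, z]
    · have h1 : ¬ (t + 1 + 1 + (m + 1) < m + 2) := by omega
      have h2 : ¬ (t + 1 + 1 + (m + 1) = m + 2) := by omega
      rw [comp_apply, Equiv.swap_apply_of_ne_of_ne (by simp [Fin.ext_iff])
        (by simp [Fin.ext_iff])]
      simp [contract, z, Fin.ext_iff, h1, h2]
  rw [← hleft, ← hright, hS]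
  exact hA 0 (by omega) z

/-- Exchanging any inner entry with any outer entry. -/
lemma exchange_inner_outer {X : Type*} {n : ℕ} {F : (Fin n → X) → X} {hn : 2 ≤ n}
    (hA : NAssoc hn F) (hS : NSym F) (x y : Fin n → X) (b : X) {i k : Fin n} (hik : i ≠ k)
    (j : Fin n) :
    F (update (update y i (F x)) k b) =
      F (update (update y i (F (update x j b))) k (x j)) := by
  obtain ⟨m, rfl⟩ := Nat.exists_eq_add_of_le' hn
  obtain ⟨σ, h0, h1⟩ : ∃ σ : Equiv.Perm (Fin (m + 2)), σ 0 = i ∧ σ 1 = k := by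
    refine ⟨(Equiv.swap 1 (Equiv.swap 0 i k)).trans (Equiv.swap 0 i), ?_, by simp⟩
    have hne : (0 : Fin (m + 2)) ≠ Equiv.swap 0 i k := fun h =>
      hik ((Equiv.swap 0 i).injective ((Equiv.swap_apply_right 0 i).trans h))
    simp [Equiv.swap_apply_of_ne_of_ne (Fin.zero_ne_one) hne]
  have key : ∀ p q : X, F (update (update y i p) k q) =
      F (update (update (y ∘ σ) 0 p) 1 q) := fun p q => by
    subst h0 h1
    rw [← hS σ, update_comp_eq_of_injective _ σ.injective,
      update_comp_eq_of_injective _ σ.injective]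
  have hx : F (update x j b) = F (update (x ∘ Equiv.swap 0 j) 0 b) := by
    have h := update_comp_eq_of_injective x (Equiv.swap 0 j).injective 0 b
    rw [Equiv.swap_apply_left] at h
    rw [← hS (Equiv.swap 0 j), h]
  rw [key, key, hx, ← hS (Equiv.swap 0 j) x, exchange_zero_one hA hS]
  simp

/-- Exchanging an entry of one inner tuple with an entry of another. -/
lemma exchange_inner_inner {X : Type*} {n : ℕ} {F : (Fin n → X) → X} {hn : 2 ≤ n}
    (hA : NAssoc hn F) (hS : NSym F) (x w y : Fin n → X) {i k : Fin n} (hik : i ≠ k)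
    (j l : Fin n) :
    F (update (update y i (F x)) k (F w)) =
      F (update (update y i (F (update x j (w l)))) k (F (update w l (x j)))) := by
  have : Nontrivial (Fin n) := Fin.nontrivial_iff_two_le.2 hn
  obtain ⟨j', hj⟩ := exists_ne j
  have hinner : F (update x j' (F w)) =
      F (update (update x j (w l)) j' (F (update w l (x j)))) := by
    have := exchange_inner_outer hA hS w x (x j) hj l
    rwa [update_comm hj, update_eq_self, update_comm hj] at this
  rw [exchange_inner_outer hA hS x y _ hik j',
    exchange_inner_outer hA hS (update x j (w l)) y _ hik j', hinner, update_of_ne hj]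

/-- A double application of `F` to a square array is invariant under permuting the array. -/
lemma F_F_comp_perm {X : Type*} {n : ℕ} {F : (Fin n → X) → X} {hn : 2 ≤ n}
    (hA : NAssoc hn F) (hS : NSym F) (σ : Equiv.Perm (Fin n × Fin n)) :
    ∀ M : Fin n × Fin n → X,
      F (fun i => F fun j => M (σ (i, j))) = F (fun i => F fun j => M (i, j)) := by
  induction σ using Equiv.Perm.swap_induction_on with
  | one => simp
  | swap_mul f p q hpq ih =>
    intro M
    refine (ih (M ∘ Equiv.swap p q)).trans ?_
    obtain ⟨i, j⟩ := p
    obtain ⟨k, l⟩ := q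
    by_cases hik : i = k
    · subst hik
      congr 1
      funext r
      by_cases hr : r = i
      · subst hr
        rw [← hS (Equiv.swap j l) fun s => M (r, s)]
        congr 1
        funext s
        simp only [comp_apply, Equiv.swap_apply_def, Prod.mk.injEq, true_and]
        split_ifs <;> rfl
      · congr 1
        funext s
        simp [Equiv.swap_apply_def, hr]
    · have h := exchange_inner_inner hA hS (fun s => M (i, s)) (fun s => M (k, s))
        (fun r => F fun s => M (r, s)) hik j l
      have hid : update (update (fun r => F fun s => M (r, s)) i (F fun s => M (i, s))) k
          (F fun s => M (k, s)) = fun r => F fun s => M (r, s) := by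
        funext r
        simp only [update_apply]
        split_ifs <;> simp_all
      rw [hid] at h
      rw [h]
      congr 1
      funext r
      have hki : k ≠ i := Ne.symm hik
      by_cases hrk : r = k
      · subst hrk
        rw [update_self]
        congr 1
        funext s
        by_cases hs : s = l <;> simp [Equiv.swap_apply_def, hs, hki]
      · rw [update_of_ne hrk]
        by_cases hri : r = i
        · subst hri
          rw [update_self]
          congr 1
          funext s
          by_cases hs : s = j <;> simp [Equiv.swap_apply_def, hs, hik]
        · rw [update_of_ne hri]
          congr 1
          funext s
          simp [Equiv.swap_apply_def, hri, hrk]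

/-- The medial law. -/
lemma F_F_transpose {X : Type*} {n : ℕ} {F : (Fin n → X) → X} {hn : 2 ≤ n}
    (hA : NAssoc hn F) (hS : NSym F) (M : Fin n → Fin n → X) :
    F (fun i => F fun j => M i j) = F (fun j => F fun i => M i j) :=
  F_F_comp_perm hA hS (Equiv.prodComm _ _) fun p => M p.2 p.1

end NaryBand

/-- In a symmetric `n`-ary band, with `z = F(x₁,…,xₙ)`,
`F(x₁,…,xₙ) = F(ℓ_z(x₁),…,ℓ_z(xₙ))`. -/
theorem stmt_2 {X : Type*} {n : ℕ} (hn : 2 ≤ n) (F : (Fin n → X) → X)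
    (hA : NAssoc hn F) (hS : NSym F) (hI : NIdem F) :
    ∀ xs : Fin n → X, F xs = F (fun i => ell F (F xs) (xs i)) := by
  intro xs
  have hcol : ∀ j : Fin n,
      F (fun i => if (j : ℕ) < n - 1 then F xs else xs i) = F xs := fun j => by
    split_ifs
    · exact hI _
    · rfl
  simp only [ell, assocB]
  rw [F_F_transpose hA hS]
  simp only [hcol]
  exact (hI _).symm
end

section
/- Let (X,F) be a symmetric n-ary band. On the quotient X/σ, the induced n-ary operation F^σ([x₁],…,[xₙ]) = [F(x₁,…,xₙ)] is well defined and (X/σ, F^σ) is a symmetric n-ary band. Moreover, the binary operation associated with F^σ equals the induced operation B^σ([x],[y]) = [B(x,y)], B^σ is commutative (so (X/σ, B^σ) is a semilattice), and F^σ is the n-ary extension of B^σ, i.e., F^σ = (B^σ)^{n−1}. -/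
namespace NaryBand

/-- Commutation, exchange and idempotence laws of the translations `L u : y ↦ F(y, u)`
of a symmetric band of arity `m + 2`, indexed by multisets `u` of cardinality `m + 1`. -/
structure IsTranslation {X : Type*} (m : ℕ) (L : Multiset X → X → X) : Prop where
  symm : ∀ (a y : X) (u : Multiset X), u.card = m → L (a ::ₘ u) y = L (y ::ₘ u) a
  swap : ∀ (a b y : X) (u v : Multiset X), u.card = m → v.card = m →
    L (b ::ₘ v) (L (a ::ₘ u) y) = L (a ::ₘ v) (L (b ::ₘ u) y)
  idem : ∀ x : X, L (Multiset.replicate (m + 1) x) x = x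

namespace IsTranslation

variable {X : Type*} {m : ℕ} {L : Multiset X → X → X}

theorem exchange (h : IsTranslation m L) (y : X) (w : Multiset X) :
    ∀ w' u v : Multiset X, w.card = w'.card → w.card + u.card = m + 1 →
      w.card + v.card = m + 1 → L (w + u) (L (w' + v) y) = L (w' + u) (L (w + v) y) := by
  induction w using Multiset.induction_on with
  | empty =>
    intro w' u v hw _ _
    have : w' = 0 := by rw [← Multiset.card_eq_zero, ← hw]; rfl
    subst this; rfl
  | cons a w ih =>
    intro w' u v hw hu hv
    obtain ⟨b, hb⟩ : ∃ b, b ∈ w' := Multiset.card_pos_iff_exists_mem.1 (by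
      rw [← hw, Multiset.card_cons]; omega)
    obtain ⟨w', rfl⟩ := Multiset.exists_cons_of_mem hb
    simp only [Multiset.card_cons] at hw hu hv
    rw [Multiset.cons_add, Multiset.cons_add,
      h.swap b a y (w' + v) (w + u) (by simp; omega) (by simp; omega)]
    have := ih w' (b ::ₘ u) (a ::ₘ v) (by omega) (by simp; omega) (by simp; omega)
    simpa only [Multiset.add_cons, Multiset.cons_add] using this

theorem comm (h : IsTranslation m L) (y : X) {u v : Multiset X} (hu : u.card = m + 1)
    (hv : v.card = m + 1) : L u (L v y) = L v (L u y) := by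
  simpa using h.exchange y u v 0 0 (by omega) (by simpa) (by simpa)

/-- The translation `y ↦ B(x, y)`. -/
def el (m : ℕ) (L : Multiset X → X → X) (x : X) : X → X := L (Multiset.replicate (m + 1) x)

theorem el_self (h : IsTranslation m L) (x : X) : el m L x x = x := h.idem x

theorem el_comm_left (h : IsTranslation m L) (x y : X) {u : Multiset X} (hu : u.card = m + 1) :
    el m L x (L u y) = L u (el m L x y) := h.comm y (by simp) hu

theorem el_comm (h : IsTranslation m L) (x y z : X) :
    el m L x (el m L y z) = el m L y (el m L x z) := h.comm z (by simp) (by simp)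

theorem el_idem (h : IsTranslation m L) (x y : X) :
    el m L x (el m L x y) = el m L x y := by
  have hx := h.idem x
  unfold el
  rw [Multiset.replicate_succ] at *
  have e := h.symm x y (Multiset.replicate m x) (by simp)
  rw [e, h.swap y x x _ _ (by simp) (by simp), hx]

theorem el_iterate_succ (h : IsTranslation m L) (x y : X) (k : ℕ) :
    (el m L x)^[k + 1] y = el m L x y := by
  induction k with
  | zero => rfl
  | succ k ih => rw [Function.iterate_succ_apply', ih, h.el_idem]

theorem replicate_apply (h : IsTranslation m L) (a z : X) {u : Multiset X}
    (hu : u.card = m + 1) (k : ℕ) : ∀ w : Multiset X, k + w.card = m + 1 →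
      L (Multiset.replicate k (L u a) + w) z = (L u)^[k] (L (Multiset.replicate k a + w) z) := by
  induction k with
  | zero => intro w _; rfl
  | succ k ih =>
    intro w hw
    rw [Multiset.replicate_succ, Multiset.cons_add,
      h.symm _ _ _ (by simp; omega), h.comm _ (by rw [Multiset.card_cons]; simp; omega) hu,
      h.symm _ _ _ (by simp; omega), ← Multiset.add_cons, ih _ (by simp; omega),
      ← Function.iterate_succ_apply' (L u), Multiset.replicate_succ, Multiset.cons_add,
      Multiset.add_cons]

theorem el_apply (h : IsTranslation m L) (a z : X) {u : Multiset X} (hu : u.card = m + 1) :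
    el m L (L u a) z = (L u)^[m + 1] (el m L a z) := by
  simpa [el] using h.replicate_apply a z hu (m + 1) 0 (by simp)

theorem el_el (h : IsTranslation m L) (x y z : X) :
    el m L (el m L x y) z = el m L x (el m L y z) := by
  rw [← h.el_iterate_succ x (el m L y z) m]
  exact h.el_apply y z (u := Multiset.replicate (m + 1) x) (Multiset.card_replicate _ _)

theorem sigma_iff (h : IsTranslation m L) (x y : X) :
    (el m L x y = y ∧ el m L y x = x) ↔ el m L x = el m L y := by
  constructor
  · rintro ⟨hy, hx⟩
    funext z
    conv_lhs => rw [← hx, h.el_el]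
    conv_rhs => rw [← hy, h.el_el]
    exact h.el_comm _ _ _
  · intro e
    exact ⟨by rw [e, h.el_self], by rw [← e, h.el_self]⟩

theorem el_congr (h : IsTranslation m L) {a b : X} (hab : el m L a = el m L b)
    {u : Multiset X} (hu : u.card = m + 1) : el m L (L u a) = el m L (L u b) := by
  funext z
  rw [h.el_apply a z hu, h.el_apply b z hu, hab]

theorem el_map_congr (h : IsTranslation m L) {ι : Type*} {f g : ι → X}
    (hfg : ∀ i, el m L (f i) = el m L (g i)) (y : X) (s : Multiset ι) :
    ∀ w : Multiset X, s.card + w.card = m + 1 →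
      el m L (L (s.map f + w) y) = el m L (L (s.map g + w) y) := by
  induction s using Multiset.induction_on with
  | empty => intro w _; simp
  | cons i s ih =>
    intro w hw
    rw [Multiset.card_cons] at hw
    have hc : (s.map f + w).card = m := by simp; omega
    rw [Multiset.map_cons, Multiset.cons_add, h.symm _ _ _ hc,
      h.el_congr (hfg i) (by simp; omega), h.symm _ _ _ hc, ← Multiset.add_cons,
      ih _ (by simp; omega), Multiset.map_cons, Multiset.add_cons, Multiset.cons_add]

theorem map_el (h : IsTranslation m L) {ι : Type*} (f : ι → X) (q y : X) (s : Multiset ι) :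
    ∀ w : Multiset X, s.card + w.card = m + 1 →
      L (s.map (fun i => el m L q (f i)) + w) y = (el m L q)^[s.card] (L (s.map f + w) y) := by
  induction s using Multiset.induction_on with
  | empty => intro w _; simp
  | cons i s ih =>
    intro w hw
    rw [Multiset.card_cons] at hw
    rw [Multiset.map_cons, Multiset.cons_add, h.symm _ _ _ (by simp; omega),
      ← h.el_comm_left _ _ (by simp; omega), h.symm _ _ _ (by simp; omega), ← Multiset.add_cons,
      ih _ (by simp; omega), Multiset.card_cons, Multiset.map_cons, Multiset.add_cons,
      Multiset.cons_add, Function.iterate_succ_apply']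

theorem el_foldr (h : IsTranslation m L) (l : List X) (z w : X) :
    el m L (l.foldr (el m L) z) w = l.foldr (el m L) (el m L z w) := by
  induction l with
  | nil => rfl
  | cons x l ih => rw [List.foldr_cons, h.el_el, ih, List.foldr_cons]

theorem el_foldr_of_mem (h : IsTranslation m L) (l : List X) (z : X) {x : X}
    (hx : x ∈ l ∨ x = z) : el m L x (l.foldr (el m L) z) = l.foldr (el m L) z := by
  induction l with
  | nil =>
    obtain rfl : x = z := by simpa using hx
    exact h.el_self x
  | cons y l ih =>
    rw [List.foldr_cons]
    by_cases hxy : x = y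
    · subst hxy; exact h.el_idem _ _
    · rw [h.el_comm, ih (by simpa [hxy] using hx)]

theorem foldr_el_fixed {l : List X} {p : X} (hp : ∀ x ∈ l, el m L x p = p) :
    l.foldr (el m L) p = p := by
  induction l with
  | nil => rfl
  | cons x l ih =>
    rw [List.foldr_cons, ih fun y hy => hp y (List.mem_cons_of_mem _ hy), hp x (by simp)]

theorem el_absorb (h : IsTranslation m L) (y : X) {x : X} {u : Multiset X}
    (hu : u.card = m + 1) (hx : x ∈ y ::ₘ u) : el m L x (L u y) = L u y := by
  rcases Multiset.mem_cons.1 hx with rfl | hx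
  · rw [h.el_comm_left _ _ hu, h.el_self]
  · obtain ⟨u, rfl⟩ := Multiset.exists_cons_of_mem hx
    rw [Multiset.card_cons] at hu
    rw [h.symm _ _ _ (by omega), h.el_comm_left _ _ (by simp; omega), h.el_self]

/-- A value of the `n`-ary operation is `σ`-related to the iterated binary product
of its arguments, taken in any order. -/
theorem el_eq_el_foldr (h : IsTranslation m L) (y z : X) {u : Multiset X} (l : List X)
    (hu : u.card = m + 1) (hl : (z ::ₘ (l : Multiset X)) = y ::ₘ u) :
    el m L (L u y) = el m L (l.foldr (el m L) z) := by
  set q := l.foldr (el m L) z with hq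
  have hmem : ∀ x, x ∈ y ::ₘ u ↔ x = z ∨ x ∈ l := fun x => by rw [← hl]; simp
  have hp : el m L q (L u y) = L u y := by
    rw [hq, h.el_foldr, h.el_absorb y hu ((hmem z).2 (Or.inl rfl))]
    exact foldr_el_fixed fun x hx => h.el_absorb y hu ((hmem x).2 (Or.inr hx))
  have hx : ∀ x ∈ y ::ₘ u, el m L (el m L q x) = el m L q := by
    intro x hx
    funext w
    rw [h.el_el, h.el_comm, ← h.el_el, hq, h.el_foldr_of_mem l z ((hmem x).1 hx).symm]
  have h1 : L (u.map (el m L q)) (el m L q y) = L u y := by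
    have e := h.map_el id q (el m L q y) u 0 (by simpa)
    simp only [id, Multiset.map_id', add_zero] at e
    rw [← h.el_comm_left _ _ hu, hp] at e
    exact e.trans (Function.iterate_fixed hp _)
  have h2 := h.el_map_congr (ι := {x // x ∈ u}) (f := fun i => el m L q i) (g := fun _ => q)
    (fun i => hx i (Multiset.mem_cons_of_mem i.2)) (el m L q y) u.attach 0 (by simpa)
  rw [add_zero, add_zero, Multiset.attach_map_val' u (el m L q), h1, Multiset.map_const',
    Multiset.card_attach, hu] at h2
  rw [h2]
  change el m L (el m L q (el m L q y)) = _
  rw [h.el_idem, hx y (by simp)]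

end IsTranslation

theorem exists_perm_of_map_univ_eq {ι X : Type*} [Fintype ι] {f g : ι → X}
    (h : Finset.univ.val.map f = Finset.univ.val.map g) : ∃ σ : Equiv.Perm ι, f = g ∘ σ := by
  classical
  have e : ∀ c : X, Nonempty ({i // f i = c} ≃ {i // g i = c}) := by
    intro c
    rw [← Fintype.card_eq, Fintype.card_subtype, Fintype.card_subtype]
    have := congrArg (Multiset.count c) h
    rw [Multiset.count_map, Multiset.count_map] at this
    simpa only [Finset.card_def, Finset.filter_val, eq_comm (a := c)] using this
  exact ⟨Equiv.ofFiberEquiv fun c => (e c).some,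
    funext fun i => (Equiv.ofFiberEquiv_map (fun c => (e c).some) i).symm⟩

theorem exists_map_univ_eq {X : Type*} {k : ℕ} {u : Multiset X} (hu : u.card = k) :
    ∃ f : Fin k → X, Finset.univ.val.map f = u := by
  subst hu
  obtain ⟨l, rfl⟩ := Quotient.exists_rep u
  exact ⟨l.get, (Fin.univ_val_map l.get).trans (congrArg _ (List.ofFn_get l))⟩

theorem map_univ_succ {X : Type*} {k : ℕ} (f : Fin (k + 1) → X) :
    Finset.univ.val.map f = f 0 ::ₘ Finset.univ.val.map fun i : Fin k => f i.succ := by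
  rw [Fin.univ_val_map, Fin.univ_val_map, List.ofFn_succ, Multiset.cons_coe]

theorem map_univ_castSucc {X : Type*} {k : ℕ} (f : Fin (k + 1) → X) :
    Finset.univ.val.map f =
      f (Fin.last k) ::ₘ (List.ofFn fun i : Fin k => f i.castSucc : Multiset X) := by
  rw [Fin.univ_val_map, List.ofFn_succ', List.concat_eq_append, ← Multiset.coe_add, add_comm]
  rfl

theorem exists_isTranslation {X : Type*} {m : ℕ} (hn : 2 ≤ m + 2) {F : (Fin (m + 2) → X) → X}
    (hA : NAssoc hn F) (hS : NSym F) (hI : NIdem F) :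
    ∃ L : Multiset X → X → X, IsTranslation m L ∧
      ∀ (xs : Fin (m + 2) → X) (y : X) (u : Multiset X),
        Finset.univ.val.map xs = y ::ₘ u → F xs = L u y := by
  classical
  have hcongr : ∀ xs ys : Fin (m + 2) → X,
      Finset.univ.val.map xs = Finset.univ.val.map ys → F xs = F ys := by
    intro xs ys e
    obtain ⟨σ, rfl⟩ := exists_perm_of_map_univ_eq e
    exact hS σ ys
  let L : Multiset X → X → X := fun u y =>
    if h : ∃ xs : Fin (m + 2) → X, Finset.univ.val.map xs = y ::ₘ u then F h.choose else y
  have hL : ∀ (xs : Fin (m + 2) → X) (y : X) (u : Multiset X),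
      Finset.univ.val.map xs = y ::ₘ u → F xs = L u y := by
    intro xs y u e
    have h : ∃ xs : Fin (m + 2) → X, Finset.univ.val.map xs = y ::ₘ u := ⟨xs, e⟩
    simp only [L, dif_pos h]
    exact hcongr _ _ (e.trans h.choose_spec.symm)
  have hsymm : ∀ (a y : X) (u : Multiset X), u.card = m → L (a ::ₘ u) y = L (y ::ₘ u) a := by
    intro a y u hu
    obtain ⟨xs, hxs⟩ := exists_map_univ_eq (k := m + 2) (u := y ::ₘ a ::ₘ u) (by simp [hu])
    rw [← hL xs _ _ hxs, hL xs _ _ (hxs.trans (Multiset.cons_swap _ _ _))]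
  refine ⟨L, ⟨hsymm, ?_, ?_⟩, hL⟩
  · intro a b y u v hu hv
    obtain ⟨f, rfl⟩ := exists_map_univ_eq hu
    obtain ⟨g, rfl⟩ := exists_map_univ_eq hv
    have key : ∀ (c d : X) (f : Fin m → X) (xs : Fin (m + 2) → X), xs 0 = c → xs (Fin.succ 0) = d →
        (∀ i : Fin m, xs i.succ.succ = f i) → F xs = L (d ::ₘ Finset.univ.val.map f) c := by
      intro c d f xs h0 h1 h2
      refine hL _ _ _ ?_
      rw [map_univ_succ, map_univ_succ, h0, h1]
      simp only [h2]
    obtain ⟨t, h0, h1, hf, hb, hg⟩ : ∃ t : ℕ → X, t 0 = a ∧ t 1 = y ∧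
        (∀ i : Fin m, t (i + 2) = f i) ∧ t (m + 2) = b ∧ ∀ i : Fin m, t (i + 2 + m + 1) = g i := by
      refine ⟨fun k => if k = 0 then a else if k = 1 then y else
        if h : k - 2 < m then f ⟨k - 2, h⟩ else if k = m + 2 then b else
        if h : k - (m + 3) < m then g ⟨k - (m + 3), h⟩ else a, ?_, ?_, ?_, ?_, ?_⟩
      · simp
      · simp
      · simp
      · simp
      · intro i
        have e : (i : ℕ) + 2 + m + 1 - (m + 3) = i := by omega
        have h1 : ¬ ((i : ℕ) + 2 + m + 1 = 1) := by omega
        have h2 : ¬ ((i : ℕ) + 2 + m + 1 - 2 < m) := by omega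
        have h3 : ¬ ((i : ℕ) + 2 + m + 1 = m + 2) := by omega
        simp only [Nat.add_eq_zero_iff, h1, h2, h3, e, i.isLt, dif_neg, dif_pos, not_false_eq_true,
          if_false, one_ne_zero, and_false]
    have h := hA 0 (by omega) fun k => t k
    have hF0 : F (fun k : Fin (m + 2) => t (0 + k)) = L (a ::ₘ Finset.univ.val.map f) y := by
      refine (key a y f _ h0 h1 fun i => ?_).trans (hsymm _ _ _ hu)
      exact (congrArg t (Nat.zero_add _)).trans (hf i)
    have hF1 : F (fun k : Fin (m + 2) => t (0 + 1 + k)) = L (b ::ₘ Finset.univ.val.map f) y := by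
      refine hL _ _ _ ?_
      rw [map_univ_succ, map_univ_castSucc, ← Fin.univ_val_map]
      congr 2
      · rw [← hb]
        exact congrArg t (by simp; omega)
      · refine Multiset.map_congr rfl fun i _ => (congrArg t ?_).trans (hf i)
        simp; omega
    have hb' : t (0 + 1 + (m + 2) - 1) = b := (congrArg t (by omega)).trans hb
    have hg' : ∀ i : Fin m, t (i + 1 + 1 + (m + 2) - 1) = g i :=
      fun i => (congrArg t (by omega)).trans (hg i)
    rw [key _ b g (contract F 0 hn (by omega) fun k => t k) hF0 hb' hg',
      key a _ g (contract F (0 + 1) hn (by omega) fun k => t k) h0 hF1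
        fun i => by simpa [contract] using hg' i] at h
    rw [h, hsymm _ _ _ hv]
  · intro x
    rw [← hL (fun _ => x) _ _ (by simp [Multiset.replicate_succ]), hI]

end NaryBand

open NaryBand

/-- In a symmetric `n`-ary band, `σ` is an equivalence relation,
the induced operation `F^σ` on `X/σ` is well defined, `(X/σ, F^σ)` is a symmetric
`n`-ary band, its associated binary operation is the induced operation `B^σ`, `B^σ`
is commutative, and `F^σ` is the `n`-ary extension of `B^σ`. -/
theorem stmt_11 {X : Type*} {n : ℕ} (hn : 2 ≤ n) (F : (Fin n → X) → X)
    (hA : NAssoc hn F) (hS : NSym F) (hI : NIdem F) :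
    ∃ s : Setoid X, (∀ x y : X, s.r x y ↔ sigmaRel F x y) ∧
      ∃ Fq : (Fin n → Quotient s) → Quotient s,
        (∀ xs : Fin n → X, Fq (fun i => Quotient.mk s (xs i)) = Quotient.mk s (F xs)) ∧
        NAssoc hn Fq ∧ NSym Fq ∧ NIdem Fq ∧
        (∀ x y : X, assocB Fq (Quotient.mk s x) (Quotient.mk s y)
            = Quotient.mk s (assocB F x y)) ∧
        (∀ a b : Quotient s, assocB Fq a b = assocB Fq b a) ∧
        Fq = nExt (by omega) (assocB Fq) := by
  obtain ⟨m, rfl⟩ := Nat.exists_eq_add_of_le' hn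
  obtain ⟨L, h, hL⟩ := exists_isTranslation hn hA hS hI
  have hB : ∀ x y, assocB F x y = IsTranslation.el m L x y := by
    intro x y
    refine hL _ _ _ ?_
    rw [map_univ_castSucc]
    simp [List.ofFn_const]
    rfl
  have hB' : assocB F = IsTranslation.el m L := by funext x y; exact hB x y
  have hcons : ∀ xs : Fin (m + 2) → X, F xs =
      L (Finset.univ.val.map fun i : Fin (m + 1) => xs i.succ) (xs 0) := by
    intro xs
    exact hL _ _ _ (map_univ_succ xs)
  let s : Setoid X := ⟨fun x y => IsTranslation.el m L x = IsTranslation.el m L y,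
    fun _ => rfl, fun e => e.symm, fun e e' => e.trans e'⟩
  have hs : ∀ {x y : X}, Quotient.mk s x = Quotient.mk s y ↔
      IsTranslation.el m L x = IsTranslation.el m L y := fun {x y} => Quotient.eq (r := s)
  let Fq : (Fin (m + 2) → Quotient s) → Quotient s := fun qs =>
    Quotient.mk s (F fun i => (qs i).out)
  have hFq : ∀ xs : Fin (m + 2) → X,
      Fq (fun i => Quotient.mk s (xs i)) = Quotient.mk s (F xs) := by
    intro xs
    have e : ∀ i, IsTranslation.el m L (Quotient.mk s (xs i)).out =
        IsTranslation.el m L (xs i) := fun i => hs.1 (Quotient.out_eq _)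
    refine hs.2 ?_
    rw [hcons, hcons, h.el_congr (e 0) (by simp)]
    simpa using h.el_map_congr (fun i : Fin (m + 1) => e i.succ) (xs 0) Finset.univ.val 0 (by simp)
  have hlift : ∀ {k : ℕ} (qs : Fin k → Quotient s), ∃ xs : Fin k → X,
      qs = fun i => Quotient.mk s (xs i) :=
    fun qs => ⟨fun i => (qs i).out, funext fun i => (Quotient.out_eq _).symm⟩
  have hBq : ∀ x y : X, assocB Fq (Quotient.mk s x) (Quotient.mk s y)
      = Quotient.mk s (assocB F x y) := by
    intro x y
    unfold assocB
    rw [← hFq]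
    congr 1
    funext j
    split_ifs <;> rfl
  refine ⟨s, fun x y => ?_, Fq, hFq, ?_, ?_, ?_, hBq, ?_, ?_⟩
  · rw [sigmaRel, hB, hB, h.sigma_iff]
    exact Iff.rfl
  · intro i hi qs
    obtain ⟨xs, rfl⟩ := hlift qs
    have hc : ∀ (i : ℕ) (hi : i ≤ m + 2 - 1),
        contract Fq i hn hi (fun k => Quotient.mk s (xs k)) =
          fun j => Quotient.mk s (contract F i hn hi xs j) := by
      intro i hi
      funext j
      unfold contract
      split_ifs
      · rfl
      · exact hFq _
      · rfl
    rw [hc, hc, hFq, hFq, hA i hi]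
  · intro σ qs
    obtain ⟨xs, rfl⟩ := hlift qs
    rw [hFq, ← hS σ xs, ← hFq]
    rfl
  · intro q
    induction q using Quotient.inductionOn with
    | h x => rw [hFq fun _ => x, hI]
  · intro a b
    induction a, b using Quotient.inductionOn₂ with
    | h x y =>
      rw [hBq, hBq, hs, hB, hB]
      funext z
      rw [h.el_el, h.el_el, h.el_comm]
  · funext qs
    obtain ⟨xs, rfl⟩ := hlift qs
    have hfold : ∀ (l : List X) (z : X),
        (l.map (Quotient.mk s)).foldr (assocB Fq) (Quotient.mk s z) =
        Quotient.mk s (l.foldr (assocB F) z) := by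
      intro l z
      induction l with
      | nil => rfl
      | cons x l ih => rw [List.map_cons, List.foldr_cons, ih, hBq, List.foldr_cons]
    have hmap := hfold (List.ofFn fun i : Fin (m + 1) => xs i.castSucc) (xs (Fin.last _))
    rw [List.map_ofFn] at hmap
    refine (hFq xs).trans (Eq.trans ?_ hmap.symm)
    rw [hs, hcons, hB']
    refine h.el_eq_el_foldr _ _ _ (by simp) ?_
    rw [← map_univ_castSucc, map_univ_succ]
end

section
/- Let (X,F) be a symmetric n-ary band. For every x ∈ X, the σ-class [x] is closed under F, and there exists an abelian group operation * on [x] whose exponent divides n−1 and whose n-ary extension is the restriction of F to [x]^n; that is, for all y₁,…,yₙ ∈ [x], F(y₁,…,yₙ) = y₁ * y₂ * ⋯ * yₙ. -/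
open NaryBand

namespace NaryBand

/-- The value of `F` on a multiset of size `n` (the junk value `x₀` on other multisets). -/
noncomputable def multisetOp {X : Type*} {n : ℕ} (F : (Fin n → X) → X) (x₀ : X) :
    Multiset X → X :=
  Function.extend (fun v : Fin n → X => Finset.univ.val.map v) F (fun _ => x₀)

theorem exists_perm_comp_eq_of_map_univ_eq {ι X : Type*} [Fintype ι] {f g : ι → X}
    (h : Finset.univ.val.map f = Finset.univ.val.map g) :
    ∃ σ : Equiv.Perm ι, g ∘ σ = f := by
  classical
  have hcard : ∀ c, Fintype.card {a // f a = c} = Fintype.card {a // g a = c} := by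
    intro c
    have hc := congrArg (Multiset.count c) h
    rw [Multiset.count_map, Multiset.count_map] at hc
    rw [Fintype.card_subtype, Fintype.card_subtype]
    simpa only [Finset.card_def, Finset.filter_val, eq_comm] using hc
  exact ⟨Equiv.ofFiberEquiv fun c => Fintype.equivOfCardEq (hcard c),
    funext fun a => Equiv.ofFiberEquiv_map _ a⟩

theorem NSym.multisetOp_map_univ {X : Type*} {n : ℕ} {F : (Fin n → X) → X} (hS : NSym F)
    (x₀ : X) (v : Fin n → X) : multisetOp F x₀ (Finset.univ.val.map v) = F v := by
  refine Function.FactorsThrough.extend_apply (fun f g h => ?_) _ v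
  obtain ⟨σ, rfl⟩ := exists_perm_comp_eq_of_map_univ_eq h
  exact hS σ g

theorem NSym.multisetOp_ofFn {X : Type*} {n : ℕ} {F : (Fin n → X) → X} (hS : NSym F)
    (x₀ : X) (v : Fin n → X) : multisetOp F x₀ (List.ofFn v : Multiset X) = F v := by
  rw [← Fin.univ_val_map, hS.multisetOp_map_univ]

theorem NSym.multisetOp_coe {X : Type*} {n : ℕ} {F : (Fin n → X) → X} (hS : NSym F)
    (x₀ : X) {l : List X} (hl : l.length = n) :
    multisetOp F x₀ (l : Multiset X) = F fun i => l[i] := by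
  subst hl
  rw [← hS.multisetOp_ofFn x₀]
  congr 2
  exact List.ofFn_getElem.symm

theorem multisetOp_exchange {X : Type*} {n : ℕ} (hn : 2 ≤ n) {F : (Fin n → X) → X}
    (hA : NAssoc hn F) (hS : NSym F) (x₀ a b : X) {u v : Multiset X}
    (hu : u.card + 1 = n) (hv : v.card + 2 = n) :
    multisetOp F x₀ (multisetOp F x₀ (a ::ₘ u) ::ₘ b ::ₘ v) =
      multisetOp F x₀ (multisetOp F x₀ (b ::ₘ u) ::ₘ a ::ₘ v) := by
  induction u using Quotient.inductionOn with | _ u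
  induction v using Quotient.inductionOn with | _ v
  simp only [Multiset.quot_mk_to_coe, Multiset.coe_card] at *
  have h := hA 0 (by omega) fun i => (a :: (u ++ b :: v))[i]'(by
    have := i.isLt; simp only [List.length_cons, List.length_append]; omega)
  have hbu : multisetOp F x₀ (b ::ₘ (u : Multiset X)) = multisetOp F x₀ ↑(u ++ [b]) := by
    rw [← Multiset.coe_add, ← Multiset.singleton_add, add_comm]; rfl
  rw [Multiset.cons_swap _ a, hbu]
  simp only [Multiset.cons_coe]
  rw [hS.multisetOp_coe x₀ (l := a :: u) (by simpa using hu),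
    hS.multisetOp_coe x₀ (l := u ++ [b]) (by simpa using hu),
    hS.multisetOp_coe x₀ (by simpa using hv), hS.multisetOp_coe x₀ (by simpa using hv)]
  convert h using 2
  · funext j
    obtain ⟨_ | j, hj⟩ := j
    · simp only [contract, Fin.getElem_fin, List.getElem_cons_zero, lt_irrefl, dite_false,
        dite_true, zero_add]
      congr 1
      funext k
      grind
    · simp only [contract, Fin.getElem_fin]
      grind
  · funext j
    obtain ⟨_ | _ | j, hj⟩ := j
    · simp [contract]
    · simp only [contract, Fin.getElem_fin, List.getElem_cons_succ, List.getElem_cons_zero,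
        lt_irrefl, dite_false, dite_true, zero_add]
      congr 1
      funext k
      grind
    · simp only [contract, Fin.getElem_fin]
      grind

theorem multisetOp_exchange_add {X : Type*} {n : ℕ} (hn : 2 ≤ n) {F : (Fin n → X) → X}
    (hA : NAssoc hn F) (hS : NSym F) (x₀ : X) (p : Multiset X) :
    ∀ {q c d : Multiset X}, p.card = q.card → (c + p).card = n → (d + q).card + 1 = n →
      multisetOp F x₀ (multisetOp F x₀ (c + p) ::ₘ (d + q)) =
        multisetOp F x₀ (multisetOp F x₀ (c + q) ::ₘ (d + p)) := by
  induction p using Multiset.induction_on with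
  | empty =>
    intro q c d hpq _ _
    obtain rfl := Multiset.card_eq_zero.1 (hpq.symm.trans Multiset.card_zero)
    rfl
  | cons a p ih =>
    intro q c d hpq hc hd
    rw [Multiset.card_cons] at hpq
    obtain ⟨b, hb⟩ := Multiset.card_pos_iff_exists_mem.1 (by omega : 0 < q.card)
    obtain ⟨q, rfl⟩ := Multiset.exists_cons_of_mem hb
    simp only [Multiset.card_add, Multiset.card_cons] at hpq hc hd
    rw [Multiset.add_cons, Multiset.add_cons, multisetOp_exchange hn hA hS,
      ← Multiset.cons_add, ← Multiset.cons_add, ih]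
    · simp only [Multiset.cons_add, Multiset.add_cons]
    · omega
    all_goals simp only [Multiset.card_add, Multiset.card_cons]; omega

/-- Total associativity: a double product depends only on the multiset of all its arguments. -/
theorem multisetOp_multisetOp_cons {X : Type*} {n : ℕ} (hn : 2 ≤ n) {F : (Fin n → X) → X}
    (hA : NAssoc hn F) (hS : NSym F) (x₀ : X) {s t s' t' : Multiset X}
    (hs : s.card = n) (hs' : s'.card = n) (ht : t.card + 1 = n) (h : s + t = s' + t') :
    multisetOp F x₀ (multisetOp F x₀ s ::ₘ t) = multisetOp F x₀ (multisetOp F x₀ s' ::ₘ t') := by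
  classical
  have hsc : s ∩ s' + (s - s') = s := by
    ext z; simp only [Multiset.count_add, Multiset.count_inter, Multiset.count_sub]; omega
  have hsc' : s ∩ s' + (s' - s) = s' := by
    ext z; simp only [Multiset.count_add, Multiset.count_inter, Multiset.count_sub]; omega
  have htc : t - (s' - s) + (s' - s) = t := by
    ext z
    have := congrArg (Multiset.count z) h
    simp only [Multiset.count_add, Multiset.count_sub] at *; omega
  have htc' : t - (s' - s) + (s - s') = t' := by
    ext z
    have := congrArg (Multiset.count z) h
    simp only [Multiset.count_add, Multiset.count_sub] at *; omega
  have h1 := congrArg Multiset.card hsc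
  have h2 := congrArg Multiset.card hsc'
  rw [Multiset.card_add] at h1 h2
  have := multisetOp_exchange_add hn hA hS x₀ (s - s') (q := s' - s) (c := s ∩ s')
    (d := t - (s' - s)) (by omega) (by rw [hsc, hs]) (by rw [htc, ht])
  rwa [hsc, hsc', htc, htc'] at this

theorem NSym.multisetOp_cons_replicate {X : Type*} {n : ℕ} (hn : 2 ≤ n) {F : (Fin n → X) → X}
    (hS : NSym F) (x₀ x y : X) :
    multisetOp F x₀ (y ::ₘ Multiset.replicate (n - 1) x) = assocB F x y := by
  obtain ⟨m, rfl⟩ : ∃ m, n = m + 1 := ⟨n - 1, by omega⟩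
  rw [assocB, ← hS.multisetOp_map_univ x₀]
  congr 1
  rw [Fin.univ_val_map, List.ofFn_succ']
  simp only [List.concat_eq_append, Fin.val_castSucc, Fin.val_last, Nat.add_sub_cancel,
    Fin.is_lt, if_true, lt_irrefl, if_false, List.ofFn_const]
  rw [← Multiset.coe_add, add_comm, Multiset.coe_replicate]
  rfl

theorem NIdem.multisetOp_replicate {X : Type*} {n : ℕ} {F : (Fin n → X) → X} (hI : NIdem F)
    (hS : NSym F) (x₀ x : X) : multisetOp F x₀ (Multiset.replicate n x) = x := by
  have h := hS.multisetOp_ofFn x₀ fun _ => x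
  rwa [List.ofFn_const, hI, Multiset.coe_replicate] at h

/-- The elements on which `ℓ_x` acts as the identity. -/
abbrev FixedBy {X : Type*} {n : ℕ} (F : (Fin n → X) → X) (x : X) : Type _ :=
  {y : X // assocB F x y = y}

theorem assocB_multisetOp_cons {X : Type*} {n : ℕ} (hn : 2 ≤ n) {F : (Fin n → X) → X}
    (hA : NAssoc hn F) (hS : NSym F) (x₀ : X) {x y : X} (hy : assocB F x y = y) {s : Multiset X}
    (hs : s.card + 1 = n) :
    assocB F x (multisetOp F x₀ (y ::ₘ s)) = multisetOp F x₀ (y ::ₘ s) := by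
  rw [← hS.multisetOp_cons_replicate hn x₀, multisetOp_multisetOp_cons hn hA hS x₀
    (s' := y ::ₘ Multiset.replicate (n - 1) x) (t' := s) (by simpa using hs)
    (by simp; omega) (by simp; omega) (by simp only [← Multiset.singleton_add]; abel),
    hS.multisetOp_cons_replicate hn x₀, hy]

/-- `FixedBy F x` is a commutative monoid with identity `x` under
`(a, b) ↦ F(a, b, x, …, x)`. -/
noncomputable abbrev fixedByCommMonoid {X : Type*} {n : ℕ} (hn : 2 ≤ n) {F : (Fin n → X) → X}
    (hA : NAssoc hn F) (hS : NSym F) (hI : NIdem F) (x : X) : CommMonoid (FixedBy F x) where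
  mul a b := ⟨multisetOp F x (a.1 ::ₘ b.1 ::ₘ Multiset.replicate (n - 2) x),
    assocB_multisetOp_cons hn hA hS x a.2 (by simp; omega)⟩
  one := ⟨x, by
    rw [← hS.multisetOp_cons_replicate hn x, ← Multiset.replicate_succ,
      Nat.sub_add_cancel (one_le_two.trans hn), hI.multisetOp_replicate hS]⟩
  mul_assoc a b c := Subtype.ext <| by
    change multisetOp F x (multisetOp F x _ ::ₘ _) = multisetOp F x (_ ::ₘ multisetOp F x _ ::ₘ _)
    rw [Multiset.cons_swap a.1 (multisetOp F x _)]
    refine multisetOp_multisetOp_cons hn hA hS x (by simp; omega) (by simp; omega)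
      (by simp; omega) ?_
    simp only [← Multiset.singleton_add]
    abel
  mul_comm a b := Subtype.ext <| congrArg (multisetOp F x) (Multiset.cons_swap _ _ _)
  one_mul a := Subtype.ext <| by
    change multisetOp F x (x ::ₘ a.1 ::ₘ Multiset.replicate (n - 2) x) = a.1
    rw [Multiset.cons_swap, ← Multiset.replicate_succ, show n - 2 + 1 = n - 1 by omega,
      hS.multisetOp_cons_replicate hn, a.2]
  mul_one a := Subtype.ext <| by
    change multisetOp F x (a.1 ::ₘ x ::ₘ Multiset.replicate (n - 2) x) = a.1
    rw [← Multiset.replicate_succ, show n - 2 + 1 = n - 1 by omega,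
      hS.multisetOp_cons_replicate hn, a.2]

theorem multisetOp_map_add_replicate {X : Type*} {n : ℕ} (hn : 2 ≤ n) {F : (Fin n → X) → X}
    (hA : NAssoc hn F) (hS : NSym F) (hI : NIdem F) (x : X) (s : Multiset (FixedBy F x))
    (hs : s.card ≤ n) :
    letI := fixedByCommMonoid hn hA hS hI x
    multisetOp F x (s.map Subtype.val + Multiset.replicate (n - s.card) x) = s.prod.1 := by
  let := fixedByCommMonoid hn hA hS hI x
  induction s using Multiset.induction_on with
  | empty =>
    simp only [Multiset.map_zero, zero_add, Multiset.card_zero, Nat.sub_zero, Multiset.prod_zero]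
    exact hI.multisetOp_replicate hS x x
  | cons a s ih =>
    rw [Multiset.card_cons] at hs
    rw [Multiset.prod_cons, Multiset.map_cons, Multiset.card_cons]
    change _ = multisetOp F x (a.1 ::ₘ s.prod.1 ::ₘ Multiset.replicate (n - 2) x)
    rw [← ih (by omega), Multiset.cons_swap, Multiset.cons_add,
      ← assocB_multisetOp_cons hn hA hS x a.2 (by simp; omega),
      ← hS.multisetOp_cons_replicate hn x]
    refine multisetOp_multisetOp_cons hn hA hS x (by simp; omega) (by simp; omega)
      (by simp; omega) ?_
    rw [show n - s.card = n - (s.card + 1) + 1 by omega, show n - 1 = n - 2 + 1 by omega,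
      Multiset.replicate_succ, Multiset.replicate_succ]
    simp only [← Multiset.singleton_add]
    abel

theorem apply_val_eq_prod {X : Type*} {n : ℕ} (hn : 2 ≤ n) {F : (Fin n → X) → X}
    (hA : NAssoc hn F) (hS : NSym F) (hI : NIdem F) (x : X) (ys : Fin n → FixedBy F x) :
    letI := fixedByCommMonoid hn hA hS hI x
    F (fun i => (ys i).1) = (∏ i, ys i).1 := by
  let := fixedByCommMonoid hn hA hS hI x
  have h := multisetOp_map_add_replicate hn hA hS hI x (Finset.univ.val.map ys) (by simp)
  rw [Multiset.map_map, Multiset.card_map, Finset.card_val, Finset.card_univ, Fintype.card_fin,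
    Nat.sub_self, Multiset.replicate_zero, add_zero, hS.multisetOp_map_univ] at h
  exact h

theorem assocB_val_eq_pow {X : Type*} {n : ℕ} (hn : 2 ≤ n) {F : (Fin n → X) → X}
    (hA : NAssoc hn F) (hS : NSym F) (hI : NIdem F) (x : X) (y : FixedBy F x) :
    letI := fixedByCommMonoid hn hA hS hI x
    assocB F y.1 x = (y ^ (n - 1)).1 := by
  let := fixedByCommMonoid hn hA hS hI x
  have h := multisetOp_map_add_replicate hn hA hS hI x (Multiset.replicate (n - 1) y) (by simp)
  rw [Multiset.map_replicate, Multiset.card_replicate, Multiset.prod_replicate,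
    show n - (n - 1) = 1 by omega, Multiset.replicate_one, add_comm, Multiset.singleton_add,
    hS.multisetOp_cons_replicate hn] at h
  exact h

theorem map_powMul {A M : Type*} [Monoid M] (f : A → M) {mul : A → A → A} {e : A}
    (hmul : ∀ a b, f (mul a b) = f a * f b) (he : f e = 1) (k : ℕ) (a : A) :
    f (powMul mul e k a) = f a ^ k := by
  induction k with
  | zero => rw [powMul, he, pow_zero]
  | succ k ih => rw [powMul, hmul, ih, pow_succ']

theorem map_foldr_op {A M : Type*} [Monoid M] (f : A → M) {mul : A → A → A}
    (hmul : ∀ a b, f (mul a b) = f a * f b) (l : List A) (b : A) :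
    f (l.foldr mul b) = (l.map f).prod * f b := by
  induction l with
  | nil => simp
  | cons a l ih => simp [hmul, ih, mul_assoc]

theorem map_nExt {A M : Type*} [CommMonoid M] (f : A → M) {mul : A → A → A}
    (hmul : ∀ a b, f (mul a b) = f a * f b) {n : ℕ} (hn : 1 ≤ n) (ys : Fin n → A) :
    f (nExt hn mul ys) = ∏ i, f (ys i) := by
  obtain ⟨m, rfl⟩ : ∃ m, n = m + 1 := ⟨n - 1, by omega⟩
  rw [nExt, map_foldr_op f hmul, List.map_ofFn, List.prod_ofFn, Fin.prod_univ_castSucc]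
  rfl

end NaryBand

/-- In a symmetric `n`-ary band, each `σ`-class `[x]` is closed
under `F`, and carries an abelian group structure of exponent dividing `n-1` whose
`n`-ary extension is the restriction of `F` to `[x]ⁿ`. -/
theorem stmt_12 {X : Type*} {n : ℕ} (hn : 2 ≤ n) (F : (Fin n → X) → X)
    (hA : NAssoc hn F) (hS : NSym F) (hI : NIdem F) :
    ∀ x : X,
      (∀ xs : Fin n → X, (∀ i, sigmaRel F x (xs i)) → sigmaRel F x (F xs)) ∧
      ∃ (mul : {y : X // sigmaRel F x y} → {y : X // sigmaRel F x y} → {y : X // sigmaRel F x y})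
        (e : {y : X // sigmaRel F x y})
        (inv : {y : X // sigmaRel F x y} → {y : X // sigmaRel F x y}),
        IsAbelianGroup mul e inv ∧
        (∀ a, powMul mul e (n - 1) a = e) ∧
        (∀ ys : Fin n → {y : X // sigmaRel F x y},
          F (fun i => ((ys i : {y : X // sigmaRel F x y}) : X))
            = ((nExt (show 1 ≤ n by omega) mul ys : {y : X // sigmaRel F x y}) : X)) := by
  intro x
  let := fixedByCommMonoid hn hA hS hI x
  have hσ (y : X) : sigmaRel F x y ↔ ∃ a : FixedBy F x, a.1 = y ∧ a ^ (n - 1) = 1 := by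
    constructor
    · rintro ⟨h1, h2⟩
      exact ⟨⟨y, h1⟩, rfl, Subtype.ext ((assocB_val_eq_pow hn hA hS hI x ⟨y, h1⟩).symm.trans h2)⟩
    · rintro ⟨a, rfl, ha⟩
      exact ⟨a.2, (assocB_val_eq_pow hn hA hS hI x a).trans (congrArg Subtype.val ha)⟩
  let f : {y : X // sigmaRel F x y} → FixedBy F x := fun y => ⟨y.1, y.2.1⟩
  have hf : Function.Injective f := fun a b h => Subtype.ext (congrArg (fun z : FixedBy F x => z.1) h)
  have hpow (y) : f y ^ (n - 1) = 1 := by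
    obtain ⟨a, ha, h⟩ := (hσ y.1).1 y.2
    rwa [show f y = a from Subtype.ext ha.symm]
  have hmem {a : FixedBy F x} (ha : a ^ (n - 1) = 1) : sigmaRel F x a.1 := (hσ a.1).2 ⟨a, rfl, ha⟩
  let mul : {y : X // sigmaRel F x y} → {y : X // sigmaRel F x y} → {y : X // sigmaRel F x y} :=
    fun a b => ⟨(f a * f b).1, hmem (by rw [mul_pow, hpow, hpow, one_mul])⟩
  let e : {y : X // sigmaRel F x y} := ⟨(1 : FixedBy F x).1, hmem (one_pow _)⟩
  let inv : {y : X // sigmaRel F x y} → {y : X // sigmaRel F x y} :=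
    fun a => ⟨(f a ^ (n - 2)).1, hmem (by rw [← pow_mul, mul_comm, pow_mul, hpow, one_pow])⟩
  have hmul (a b) : f (mul a b) = f a * f b := rfl
  have he : f e = 1 := rfl
  have hinv (a) : f (inv a) = f a ^ (n - 2) := rfl
  refine ⟨fun xs hxs => ?_, mul, e, inv,
    ⟨fun a b c => hf ?_, fun a b => hf ?_, fun a => hf ?_, fun a => hf ?_⟩,
    fun a => hf ?_, fun ys => ?_⟩
  · rw [apply_val_eq_prod hn hA hS hI x fun i => f ⟨xs i, hxs i⟩]
    exact hmem (by simp_rw [← Finset.prod_pow, hpow, Finset.prod_const_one])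
  · rw [hmul, hmul, hmul, hmul, mul_assoc]
  · rw [hmul, hmul, mul_comm]
  · rw [hmul, he, one_mul]
  · rw [hmul, hinv, he, ← pow_succ, show n - 2 + 1 = n - 1 by omega, hpow]
  · rw [map_powMul f hmul he, hpow, he]
  · rw [apply_val_eq_prod hn hA hS hI x fun i => f (ys i), ← map_nExt f hmul]
end

section
/- Let (X,F) be a symmetric n-ary band. Then X decomposes as a strong n-ary semilattice of n-ary extensions of abelian groups whose exponents divide n−1. Concretely: (1) σ is a congruence for F and the quotient (X/σ, F^σ) is the n-ary extension of a semilattice; (2) each σ-class [x] is closed under F and carries an abelian group structure of exponent dividing n−1 whose n-ary extension is the restriction of F; (3) for [x] ≥ [y] the map φ_{[x],[y]} = ℓ_y restricted to [x] maps [x] into [y], φ_{[x],[x]} is the identity on [x], φ_{[y],[z]} ∘ φ_{[x],[y]} = φ_{[x],[z]} whenever [x] ≥ [y] ≥ [z], and each φ_{[x],[y]} is a homomorphism for F; and (4) for all x₁,…,xₙ ∈ X, writing z = F(x₁,…,xₙ), one has ℓ_z(x_i) ∈ [z] for each i and F(x₁,…,xₙ) = F(ℓ_z(x₁),…,ℓ_z(xₙ)).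 -/
open NaryBand

namespace NaryBand

universe u

section Evaluation

variable {X : Type*} {n : ℕ}

/-- The value of `F` on a list of length `n`; the head `x` is given separately. -/
def listOp (F : (Fin n → X) → X) (x : X) (l : List X) : X :=
  F fun i => (x :: l).getD i x

theorem listOp_perm {F : (Fin n → X) → X} (hS : NSym F) {x y : X} {l m : List X}
    (hl : (x :: l).length = n) (h : (x :: l).Perm (y :: m)) : listOp F x l = listOp F y m := by
  classical
  have hm : (y :: m).length = n := h.length_eq.symm.trans hl
  let p : Fin n → Fin n := fun i => (h.idxBij (i.cast hl.symm)).cast hm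
  have hp : Function.Injective p :=
    (Fin.cast_injective hm).comp (h.idxBij_injective.comp (Fin.cast_injective hl.symm))
  refine Eq.trans (congrArg F (funext fun i => ?_))
    (hS (Equiv.ofBijective p (Finite.injective_iff_bijective.1 hp)) _)
  have hi := h.getElem_idxBij_eq_getElem (i.cast hl.symm)
  have hpi : (p i : ℕ) < (y :: m).length := hm.symm ▸ (p i).isLt
  have hi' : (i : ℕ) < (x :: l).length := hl.symm ▸ i.isLt
  simp only [Function.comp_apply, Equiv.ofBijective_apply]
  rw [List.getD_eq_getElem _ _ hpi, List.getD_eq_getElem _ _ hi']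
  exact hi.symm

theorem listOp_assoc {hn : 2 ≤ n} {F : (Fin n → X) → X} (hA : NAssoc hn F) (x y z : X)
    (l t : List X) (hl : l.length + 2 = n) (ht : t.length + 2 = n) :
    listOp F (listOp F x (y :: l)) (z :: t) = listOp F x (listOp F y (l ++ [z]) :: t) := by
  have h := hA 0 (by omega) (fun i => (x :: y :: l ++ z :: t).getD i x)
  unfold listOp
  convert h using 2
  · funext j
    rcases j with ⟨_ | j, hj⟩
    · change F _ = contract F 0 hn _ _ ⟨0, hj⟩
      simp
      congr 1
      funext k
      grind
    · simp [contract]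
      grind
  · funext j
    rcases j with ⟨_ | _ | j, hj⟩
    · simp [contract]
    · simp [contract]
      congr 1
      funext k
      grind
    · simp [contract]
      grind

theorem listOp_exchange {hn : 2 ≤ n} {F : (Fin n → X) → X} (hA : NAssoc hn F) (hS : NSym F)
    (x a b : X) (l t : List X) (hl : l.length + 2 = n) (ht : t.length + 2 = n) :
    listOp F (listOp F x (l ++ [a])) (b :: t) = listOp F (listOp F x (l ++ [b])) (a :: t) := by
  have h₁ : listOp F x (l ++ [a]) = listOp F a (x :: l) :=
    listOp_perm hS (by simp; omega) (List.perm_append_singleton a (x :: l))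
  rw [h₁, listOp_assoc hA a x b l t hl ht]
  exact listOp_perm hS (by simp; omega) (List.Perm.swap _ _ _)

/-- Evaluate a word by repeatedly contracting its first `n` letters. -/
def wordReduce (hn : 2 ≤ n) (F : (Fin n → X) → X) (x : X) (l : List X) : Option X :=
  if l = [] then some x
  else if l.length < n - 1 then none
  else wordReduce hn F (listOp F x (l.take (n - 1))) (l.drop (n - 1))
termination_by l.length
decreasing_by
  rw [List.length_drop]
  omega

theorem wordReduce_of_length_lt (hn : 2 ≤ n) (F : (Fin n → X) → X) (x : X) {l : List X}
    (h₀ : l ≠ []) (hl : l.length < n - 1) : wordReduce hn F x l = none := by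
  rw [wordReduce, if_neg h₀, if_pos hl]

/-- `wordReduce` on a possibly empty word. -/
def wordValue (hn : 2 ≤ n) (F : (Fin n → X) → X) : List X → Option X
  | [] => none
  | x :: l => wordReduce hn F x l

theorem wordReduce_nil (hn : 2 ≤ n) (F : (Fin n → X) → X) (x : X) : wordReduce hn F x [] = some x := by
  rw [wordReduce, if_pos rfl]

theorem wordReduce_append (hn : 2 ≤ n) (F : (Fin n → X) → X) (x : X) (s u : List X)
    (hs : s.length + 1 = n) : wordReduce hn F x (s ++ u) = wordReduce hn F (listOp F x s) u := by
  have hs' : n - 1 = s.length := by omega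
  rw [wordReduce, if_neg (by rintro h; simp_all; omega), if_neg (by simp; omega), hs',
    List.take_left, List.drop_left]

theorem wordReduce_swap {hn : 2 ≤ n} {F : (Fin n → X) → X} (hA : NAssoc hn F) (hS : NSym F)
    (a b : X) (x : X) (u v : List X) :
    wordReduce hn F x (u ++ a :: b :: v) = wordReduce hn F x (u ++ b :: a :: v) := by
  induction hk : u.length using Nat.strong_induction_on generalizing x u with
  | _ k ih =>
    subst hk
    rcases lt_or_ge (u.length + 2 + v.length) (n - 1) with h | h
    · rw [wordReduce_of_length_lt _ _ _ (by simp) (by simp; omega),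
        wordReduce_of_length_lt _ _ _ (by simp) (by simp; omega)]
    rcases le_or_gt (n - 1) u.length with hu | hu
    · obtain ⟨s, r, rfl, hs⟩ : ∃ s r, u = s ++ r ∧ s.length = n - 1 :=
        ⟨u.take (n - 1), u.drop (n - 1), by simp, by simp; omega⟩
      rw [List.append_assoc, List.append_assoc, wordReduce_append hn F x s _ (by omega),
        wordReduce_append hn F x s _ (by omega)]
      exact ih _ (by simp; omega) _ _ rfl
    rcases eq_or_ne (u.length + 2) n with hu2 | hu2
    · have e : ∀ c d : X, u ++ c :: d :: v = (u ++ [c]) ++ d :: v := by simp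
      rw [e, e, wordReduce_append hn F _ _ _ (by simp; omega), wordReduce_append hn F _ _ _ (by simp; omega)]
      rcases lt_or_ge (1 + v.length) (n - 1) with hv | hv
      · rw [wordReduce_of_length_lt _ _ _ (by simp) (by simp; omega),
        wordReduce_of_length_lt _ _ _ (by simp) (by simp; omega)]
      · obtain ⟨s, r, rfl, hs⟩ : ∃ s r, v = s ++ r ∧ s.length = n - 2 :=
          ⟨v.take (n - 2), v.drop (n - 2), by simp, by simp; omega⟩
        rw [← List.cons_append, ← List.cons_append, wordReduce_append hn F _ _ _ (by simp; omega),
          wordReduce_append hn F _ _ _ (by simp; omega),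
          listOp_exchange hA hS x a b u s hu2 (by omega)]
    · obtain ⟨s, r, rfl, hs⟩ : ∃ s r, v = s ++ r ∧ s.length + u.length + 2 = n - 1 :=
        ⟨v.take (n - 3 - u.length), v.drop (n - 3 - u.length), by simp, by simp; omega⟩
      have e : ∀ c d : X, u ++ c :: d :: (s ++ r) = (u ++ c :: d :: s) ++ r := by simp
      rw [e, e, wordReduce_append hn F _ _ _ (by simp; omega), wordReduce_append hn F _ _ _ (by simp; omega)]
      congr 1
      exact listOp_perm hS (by simp; omega)
        (((List.Perm.swap b a s).append_left u).cons x)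

theorem wordValue_swap {hn : 2 ≤ n} {F : (Fin n → X) → X} (hA : NAssoc hn F) (hS : NSym F)
    (a b : X) (u v : List X) :
    wordValue hn F (u ++ a :: b :: v) = wordValue hn F (u ++ b :: a :: v) := by
  cases u with
  | cons x u => exact wordReduce_swap hA hS a b x u v
  | nil =>
    change wordReduce hn F a (b :: v) = wordReduce hn F b (a :: v)
    rcases lt_or_ge (1 + v.length) (n - 1) with hv | hv
    · rw [wordReduce_of_length_lt _ _ _ (by simp) (by simp; omega),
        wordReduce_of_length_lt _ _ _ (by simp) (by simp; omega)]
    · obtain ⟨s, r, rfl, hs⟩ : ∃ s r, v = s ++ r ∧ s.length = n - 2 :=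
        ⟨v.take (n - 2), v.drop (n - 2), by simp, by simp; omega⟩
      rw [← List.cons_append, ← List.cons_append, wordReduce_append hn F _ _ _ (by simp; omega),
        wordReduce_append hn F _ _ _ (by simp; omega)]
      congr 1
      exact listOp_perm hS (by simp; omega) (List.Perm.swap _ _ _)

theorem wordValue_perm {hn : 2 ≤ n} {F : (Fin n → X) → X} (hA : NAssoc hn F) (hS : NSym F)
    {l m : List X} (h : l.Perm m) : wordValue hn F l = wordValue hn F m := by
  suffices ∀ u, wordValue hn F (u ++ l) = wordValue hn F (u ++ m) from this []
  induction h with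
  | nil => exact fun _ => rfl
  | cons x _ ih => intro u; simpa using ih (u ++ [x])
  | swap a b l => exact fun u => wordValue_swap hA hS b a u l
  | trans _ _ ih₁ ih₂ => exact fun u => (ih₁ u).trans (ih₂ u)

/-- `wordValue` on multisets. -/
def multisetValue {hn : 2 ≤ n} {F : (Fin n → X) → X} (hA : NAssoc hn F) (hS : NSym F) :
    Multiset X → Option X :=
  Quotient.lift (wordValue hn F) fun _ _ h => wordValue_perm hA hS h

/-- The syntactic congruence of `multisetValue`. -/
def valueCon {hn : 2 ≤ n} {F : (Fin n → X) → X} (hA : NAssoc hn F) (hS : NSym F) :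
    AddCon (Multiset X) where
  r s t := ∀ u, multisetValue hA hS (s + u) = multisetValue hA hS (t + u)
  iseqv := ⟨fun _ _ => rfl, fun h u => (h u).symm, fun h k u => (h u).trans (k u)⟩
  add' {s s' t t'} h k u := by
    rw [add_assoc, h, add_left_comm, k, add_left_comm, add_assoc]

/-- A symmetric `n`-ary semigroup embeds in a commutative monoid. -/
theorem exists_embedding {X : Type u} {hn : 2 ≤ n} {F : (Fin n → X) → X} (hA : NAssoc hn F)
    (hS : NSym F) : ∃ (M : Type u) (_ : CommMonoid M) (ι : X → M), Function.Injective ι ∧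
      ∀ xs, ι (F xs) = ∏ i, ι (xs i) := by
  refine ⟨Multiplicative (valueCon hA hS).Quotient, inferInstance,
    fun x => Multiplicative.ofAdd ((valueCon hA hS).mk' {x}), ?_, ?_⟩
  · intro x y h
    have h' := (AddCon.eq _).1 (Multiplicative.ofAdd.injective h) 0
    change wordReduce hn F x [] = wordReduce hn F y [] at h'
    rw [wordReduce_nil, wordReduce_nil] at h'
    exact Option.some_injective _ h'
  · intro xs
    rw [← ofAdd_sum, ← map_sum]
    refine (AddCon.eq _).2 ?_
    intro u
    induction u using Quotient.inductionOn with
    | _ u =>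
    have hms : (∑ i, {xs i} : Multiset X) = (List.ofFn xs : Multiset X) := by
      rw [← Fin.univ_val_map, ← Multiset.sum_map_singleton (Multiset.map xs _), Multiset.map_map]
      rfl
    rw [hms]
    obtain ⟨k, rfl⟩ : ∃ k, n = k + 1 := ⟨n - 1, by omega⟩
    change wordReduce hn F (F xs) u = wordValue hn F (List.ofFn xs ++ u)
    rw [List.ofFn_succ, List.cons_append]
    change _ = wordReduce hn F _ (_ ++ u)
    rw [wordReduce_append hn F _ _ _ (by simp), listOp]
    congr 2
    funext i
    cases i using Fin.cases <;> simp

end Evaluation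

section Representation

variable {X M : Type*} {n : ℕ} {F : (Fin n → X) → X} [CommMonoid M] {ι : X → M}

theorem map_nExt_s16 {A : Type*} (hn : 1 ≤ n) {G : A → A → A} {φ : A → M} {c : M}
    (hφ : ∀ a b, φ (G a b) = φ a * φ b * c) (x : Fin n → A) :
    φ (nExt hn G x) = (∏ i, φ (x i)) * c ^ (n - 1) := by
  have hfold : ∀ (l : List A) (z : A),
      φ (l.foldr G z) = (l.map φ).prod * φ z * c ^ l.length := by
    intro l z
    induction l with
    | nil => simp
    | cons a l ih =>
      simp only [List.foldr_cons, hφ, ih, List.map_cons, List.prod_cons, List.length_cons, pow_succ]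
      ac_rfl
  obtain ⟨k, rfl⟩ : ∃ k, n = k + 1 := ⟨n - 1, by omega⟩
  rw [nExt, hfold, List.map_ofFn, List.prod_ofFn, List.length_ofFn, Fin.prod_univ_castSucc]
  rfl

theorem map_assocB (hn : 2 ≤ n) (hι : ∀ xs, ι (F xs) = ∏ i, ι (xs i)) (x y : X) :
    ι (assocB F x y) = ι x ^ (n - 1) * ι y := by
  obtain ⟨k, rfl⟩ : ∃ k, n = k + 1 := ⟨n - 1, by omega⟩
  simp [assocB, hι, Fin.prod_univ_castSucc]

theorem map_pow_sub_one_mul (hn : 2 ≤ n) (hI : NIdem F) (hι : ∀ xs, ι (F xs) = ∏ i, ι (xs i))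
    (x : X) : ι x ^ (n - 1) * ι x = ι x := by
  have h := hι fun _ => x
  rw [hI, Finset.prod_const, Finset.card_univ, Fintype.card_fin] at h
  rw [← pow_succ, Nat.sub_add_cancel (by omega), ← h]

theorem isIdempotentElem_map_pow (hn : 2 ≤ n) (hI : NIdem F)
    (hι : ∀ xs, ι (F xs) = ∏ i, ι (xs i)) (x : X) : IsIdempotentElem (ι x ^ (n - 1)) := by
  obtain ⟨k, rfl⟩ : ∃ k, n = k + 2 := ⟨n - 2, by omega⟩
  have h := map_pow_sub_one_mul hn hI hι x
  change ι x ^ (k + 1) * ι x = ι x at h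
  change ι x ^ (k + 1) * ι x ^ (k + 1) = ι x ^ (k + 1)
  calc ι x ^ (k + 1) * ι x ^ (k + 1) = ι x ^ (k + 1) * ι x * ι x ^ k := by
        rw [mul_assoc, ← pow_succ']
    _ = ι x ^ (k + 1) := by rw [h, ← pow_succ']

theorem sigmaRel_iff (hn : 2 ≤ n) (hI : NIdem F) (hinj : Function.Injective ι)
    (hι : ∀ xs, ι (F xs) = ∏ i, ι (xs i)) (x y : X) :
    sigmaRel F x y ↔ ι x ^ (n - 1) = ι y ^ (n - 1) := by
  have key : ∀ a b : X, assocB F a b = b → ι a ^ (n - 1) * ι b ^ (n - 1) = ι b ^ (n - 1) := by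
    intro a b h
    have hb : ι b = ι a ^ (n - 1) * ι b := by rw [← map_assocB hn hι, h]
    have hp := congrArg (· ^ (n - 1)) hb
    simp only [mul_pow] at hp
    rw [(isIdempotentElem_map_pow hn hI hι a).pow_eq (by omega)] at hp
    exact hp.symm
  constructor
  · rintro ⟨hxy, hyx⟩
    rw [← key x y hxy, mul_comm, key y x hyx]
  · intro h
    refine ⟨hinj ?_, hinj ?_⟩
    · rw [map_assocB hn hι, h, map_pow_sub_one_mul hn hI hι]
    · rw [map_assocB hn hι, ← h, map_pow_sub_one_mul hn hI hι]

theorem exists_map_eq_list_prod (hι : ∀ xs, ι (F xs) = ∏ i, ι (xs i)) (l : List X)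
    (hl : l.length = n) : ∃ z, ι z = (l.map ι).prod := by
  subst hl
  refine ⟨F l.get, ?_⟩
  rw [hι, ← List.prod_ofFn]
  congr 1
  exact List.map_ofFn.symm.trans (by rw [List.ofFn_get])

theorem map_op_pow (hι : ∀ xs, ι (F xs) = ∏ i, ι (xs i)) (xs : Fin n → X) (k : ℕ) :
    ι (F xs) ^ k = ∏ i, ι (xs i) ^ k := by
  rw [hι, Finset.prod_pow]

theorem exists_semilattice (hn : 2 ≤ n) (hn₁ : 1 ≤ n) (hI : NIdem F) (hinj : Function.Injective ι)
    (hι : ∀ xs, ι (F xs) = ∏ i, ι (xs i)) :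
    ∃ s : Setoid X, (∀ x y : X, s.r x y ↔ sigmaRel F x y) ∧
      ∃ Fq : (Fin n → Quotient s) → Quotient s,
        (∀ xs : Fin n → X,
          Fq (fun i => Quotient.mk s (xs i)) = Quotient.mk s (F xs)) ∧
        ∃ m : Quotient s → Quotient s → Quotient s,
          (∀ a b c, m (m a b) c = m a (m b c)) ∧
          (∀ a b, m a b = m b a) ∧ (∀ a, m a a = a) ∧
          Fq = nExt hn₁ m := by
  let s : Setoid X := Setoid.ker fun x => ι x ^ (n - 1)
  let ε : Quotient s → M := Quotient.lift (fun x => ι x ^ (n - 1)) fun _ _ h => h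
  have hε : Function.Injective ε := by
    rintro ⟨x⟩ ⟨y⟩ h
    exact Quotient.sound h
  let m : Quotient s → Quotient s → Quotient s :=
    fun a b => Quotient.mk s (assocB F a.out b.out)
  have hout : ∀ a : Quotient s, ι a.out ^ (n - 1) = ε a := fun a =>
    congrArg ε a.out_eq
  have hm : ∀ a b, ε (m a b) = ε a * ε b := by
    intro a b
    change ι (assocB F a.out b.out) ^ (n - 1) = _
    rw [map_assocB hn hι, mul_pow, (isIdempotentElem_map_pow hn hI hι _).pow_eq (by omega),
      hout, hout]
  refine ⟨s, fun x y => (sigmaRel_iff hn hI hinj hι x y).symm, nExt hn₁ m, ?_, m,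
    ?_, ?_, ?_, rfl⟩
  · intro xs
    apply hε
    have hm' : ∀ a b, ε (m a b) = ε a * ε b * 1 := by simpa using hm
    rw [map_nExt_s16 hn₁ hm', one_pow, mul_one]
    exact (map_op_pow hι xs (n - 1)).symm
  · exact fun a b c => hε (by simp only [hm, mul_assoc])
  · exact fun a b => hε (by simp only [hm, mul_comm])
  · refine fun a => hε ?_
    rw [hm, ← hout]
    exact isIdempotentElem_map_pow hn hI hι _

theorem exists_abelianGroup (hn : 2 ≤ n) (hn₁ : 1 ≤ n) (hI : NIdem F) (hinj : Function.Injective ι)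
    (hι : ∀ xs, ι (F xs) = ∏ i, ι (xs i)) (x : X) :
    ∃ (mul : {y : X // sigmaRel F x y} → {y : X // sigmaRel F x y} → {y : X // sigmaRel F x y})
      (e : {y : X // sigmaRel F x y})
      (inv : {y : X // sigmaRel F x y} → {y : X // sigmaRel F x y}),
      IsAbelianGroup mul e inv ∧
      (∀ a, powMul mul e (n - 1) a = e) ∧
      (∀ ys : Fin n → {y : X // sigmaRel F x y},
        F (fun i => ((ys i : {y : X // sigmaRel F x y}) : X))
          = ((nExt hn₁ mul ys : {y : X // sigmaRel F x y}) : X)) := by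
  obtain ⟨k, rfl⟩ : ∃ k, n = k + 2 := ⟨n - 2, by omega⟩
  have hσ := sigmaRel_iff hn hI hinj hι
  have hid := isIdempotentElem_map_pow hn hI hι x
  have hunit := map_pow_sub_one_mul hn hI hι
  simp only [show k + 2 - 1 = k + 1 from rfl] at hσ hid hunit ⊢
  let φ : {y : X // sigmaRel F x y} → M := fun y => ι y
  have hφ : Function.Injective φ := hinj.comp Subtype.val_injective
  have hpow : ∀ a, φ a ^ (k + 1) = ι x ^ (k + 1) := fun a => ((hσ x a).1 a.2).symm
  have hact : ∀ a, ι x ^ (k + 1) * φ a = φ a := fun a => by rw [← hpow a]; exact hunit a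
  have hmul : ∀ a b : {y : X // sigmaRel F x y},
      ∃ c : {y : X // sigmaRel F x y}, φ c = φ a * φ b * ι x ^ k := by
    intro a b
    obtain ⟨z, hz⟩ := exists_map_eq_list_prod hι (a :: b :: List.replicate k x) (by simp)
    have hz' : ι z = φ a * φ b * ι x ^ k := by simpa [mul_assoc] using hz
    refine ⟨⟨z, (hσ x z).2 ?_⟩, hz'⟩
    rw [hz', mul_pow, mul_pow, hpow, hpow, hid.eq, pow_right_comm, ← pow_succ']
    exact (hid.pow_eq (by omega)).symm
  have hinv : ∀ a : {y : X // sigmaRel F x y},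
      ∃ c : {y : X // sigmaRel F x y}, φ c = φ a ^ k * (ι x * ι x) := by
    intro a
    obtain ⟨z, hz⟩ := exists_map_eq_list_prod hι (x :: x :: List.replicate k (a : X)) (by simp)
    have hz' : ι z = φ a ^ k * (ι x * ι x) := by
      rw [hz, mul_comm]
      simp [φ, mul_assoc]
    refine ⟨⟨z, (hσ x z).2 ?_⟩, hz'⟩
    rw [hz', mul_pow, mul_pow, pow_right_comm, hpow, hid.eq, ← pow_succ]
    exact (hid.pow_eq (by omega)).symm
  choose mul hmul using hmul
  choose inv hinv using hinv
  let e : {y : X // sigmaRel F x y} := ⟨x, (hσ x x).2 rfl⟩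
  have he : φ e = ι x := rfl
  refine ⟨mul, e, inv, ⟨?_, ?_, ?_, ?_⟩, ?_, ?_⟩
  · refine fun a b c => hφ ?_
    simp only [hmul]
    ac_rfl
  · refine fun a b => hφ ?_
    simp only [hmul]
    ac_rfl
  · refine fun a => hφ ?_
    rw [hmul, he, mul_right_comm, ← pow_succ', hact]
  · refine fun a => hφ ?_
    calc φ (mul (inv a) a) = φ a ^ (k + 1) * ι x ^ (k + 1) * ι x := by
          rw [hmul, hinv, pow_succ, pow_succ]; ac_rfl
      _ = φ e := by rw [hpow, hid.eq]; exact hunit x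
  · intro a
    have hpm : ∀ j, φ (powMul mul e j a) = φ a ^ j * (ι x * (ι x ^ k) ^ j) := by
      intro j
      induction j with
      | zero => simp [powMul, he]
      | succ j ih =>
        rw [powMul, hmul, ih, pow_succ, pow_succ]
        ac_rfl
    apply hφ
    rw [hpm, hpow, mul_left_comm, pow_right_comm, ← pow_succ', hid.pow_eq (by omega), mul_comm]
    exact hunit x
  · intro ys
    apply hinj
    change _ = φ _
    rw [map_nExt_s16 hn₁ hmul, hι, Fin.prod_univ_succ]
    change _ = _ * (ι x ^ k) ^ (k + 1)
    rw [pow_right_comm, Fin.prod_univ_succ]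
    have h0 : ∀ j, φ (ys 0) * (ι x ^ (k + 1)) ^ j = φ (ys 0) := by
      intro j
      induction j with
      | zero => rw [pow_zero, mul_one]
      | succ j ih => rw [pow_succ, ← mul_assoc, ih, mul_comm, hact]
    rw [mul_right_comm, h0]

end Representation

end NaryBand

/-- Structure theorem (forward direction): every symmetric
`n`-ary band decomposes as a strong `n`-ary semilattice of `n`-ary extensions of
abelian groups whose exponents divide `n-1`. Concretely:
(1) `σ` is a congruence for `F` and the quotient `(X/σ, F^σ)` is the `n`-ary
extension of a semilattice;
(2) each `σ`-class is closed under `F` and carries an abelian group structure of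
exponent dividing `n-1` whose `n`-ary extension is the restriction of `F`;
(3) for `[x] ≥ [y]`, `φ_{[x],[y]} = ℓ_y|_{[x]}` maps `[x]` into `[y]`,
`φ_{[x],[x]}` is the identity on `[x]`, the maps compose correctly along
`[x] ≥ [y] ≥ [z]`, and each is a homomorphism for `F`;
(4) with `z = F(x₁,…,xₙ)`, each `ℓ_z(xᵢ)` lies in `[z]` and
`F(x₁,…,xₙ) = F(ℓ_z(x₁),…,ℓ_z(xₙ))`. -/
theorem stmt_16 {X : Type*} {n : ℕ} (hn : 2 ≤ n) (F : (Fin n → X) → X)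
    (hA : NAssoc hn F) (hS : NSym F) (hI : NIdem F) :
    -- (1) σ is a congruence and the quotient is the n-ary extension of a semilattice
    ((∀ xs ys : Fin n → X, (∀ i, sigmaRel F (xs i) (ys i)) →
        sigmaRel F (F xs) (F ys)) ∧
      ∃ s : Setoid X, (∀ x y : X, s.r x y ↔ sigmaRel F x y) ∧
        ∃ Fq : (Fin n → Quotient s) → Quotient s,
          (∀ xs : Fin n → X,
            Fq (fun i => Quotient.mk s (xs i)) = Quotient.mk s (F xs)) ∧
          ∃ m : Quotient s → Quotient s → Quotient s,
            (∀ a b c, m (m a b) c = m a (m b c)) ∧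
            (∀ a b, m a b = m b a) ∧ (∀ a, m a a = a) ∧
            Fq = nExt (show 1 ≤ n by omega) m) ∧
    -- (2) each σ-class carries an abelian group of exponent dividing n-1
    --     whose n-ary extension is the restriction of F
    (∀ x : X,
      (∀ xs : Fin n → X, (∀ i, sigmaRel F x (xs i)) → sigmaRel F x (F xs)) ∧
      ∃ (mul : {y : X // sigmaRel F x y} → {y : X // sigmaRel F x y} → {y : X // sigmaRel F x y})
        (e : {y : X // sigmaRel F x y})
        (inv : {y : X // sigmaRel F x y} → {y : X // sigmaRel F x y}),
        IsAbelianGroup mul e inv ∧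
        (∀ a, powMul mul e (n - 1) a = e) ∧
        (∀ ys : Fin n → {y : X // sigmaRel F x y},
          F (fun i => ((ys i : {y : X // sigmaRel F x y}) : X))
            = ((nExt (show 1 ≤ n by omega) mul ys : {y : X // sigmaRel F x y}) : X))) ∧
    -- (3) the structure maps φ_{[x],[y]} = ℓ_y|_{[x]}
    ((∀ x y : X, assocB F x y = y → ∀ z : X, sigmaRel F x z →
        sigmaRel F y (ell F y z)) ∧
      (∀ x z : X, sigmaRel F x z → ell F x z = z) ∧
      (∀ x y z : X, assocB F x y = y → assocB F y z = z →
        ∀ w : X, sigmaRel F x w → ell F z (ell F y w) = ell F z w) ∧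
      (∀ x y : X, assocB F x y = y → ∀ xs : Fin n → X,
        (∀ i, sigmaRel F x (xs i)) →
          ell F y (F xs) = F (fun i => ell F y (xs i)))) ∧
    -- (4) F(x₁,…,xₙ) = F(ℓ_z(x₁),…,ℓ_z(xₙ)) with ℓ_z(xᵢ) ∈ [z], z = F(x₁,…,xₙ)
    (∀ xs : Fin n → X,
      (∀ i, sigmaRel F (F xs) (ell F (F xs) (xs i))) ∧
      F xs = F (fun i => ell F (F xs) (xs i))) := by
  obtain ⟨M, _, ι, hinj, hι⟩ := exists_embedding hA hS
  have hσ := sigmaRel_iff hn hI hinj hι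
  have hB := map_assocB hn hι
  have hid := isIdempotentElem_map_pow hn hI hι
  have hunit := map_pow_sub_one_mul hn hI hι
  have hF := fun xs => map_op_pow hι xs (n - 1)
  have hBp : ∀ x y, ι (assocB F x y) ^ (n - 1) = ι x ^ (n - 1) * ι y ^ (n - 1) := fun x y => by
    rw [hB, mul_pow, (hid x).pow_eq (by omega)]
  have hpown : ∀ x, (ι x ^ (n - 1)) ^ n = ι x ^ (n - 1) := fun x => (hid x).pow_eq (by omega)
  have hle : ∀ x y, assocB F x y = y → ι x ^ (n - 1) * ι y ^ (n - 1) = ι y ^ (n - 1) :=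
    fun x y h => by rw [← hBp, h]
  refine ⟨⟨?_, exists_semilattice hn (by omega) hI hinj hι⟩,
    fun x => ⟨?_, exists_abelianGroup hn (by omega) hI hinj hι x⟩, ⟨?_, ?_, ?_, ?_⟩, ?_⟩
  · intro xs ys h
    rw [hσ, hF, hF]
    exact Finset.prod_congr rfl fun i _ => (hσ _ _).1 (h i)
  · intro xs h
    rw [hσ, hF, Finset.prod_congr rfl fun i _ => ((hσ _ _).1 (h i)).symm, Finset.prod_const,
      Finset.card_univ, Fintype.card_fin, hpown]
  · intro x y hxy z hxz
    rw [hσ, ell, hBp, ← (hσ _ _).1 hxz, mul_comm, hle x y hxy]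
  · exact fun x z h => h.1
  · intro x y z _ hyz w _
    apply hinj
    rw [ell, ell, ell, hB, hB, hB, ← mul_assoc, mul_comm (ι z ^ _), hle y z hyz]
  · intro x y _ xs _
    apply hinj
    simp only [ell, hB, hι, Finset.prod_mul_distrib, Finset.prod_const, Finset.card_univ,
      Fintype.card_fin, hpown]
  · intro xs
    constructor
    · intro i
      rw [hσ, ell, hBp, hF, ← Finset.mul_prod_erase _ _ (Finset.mem_univ i), mul_right_comm,
        (hid _).eq]
    · apply hinj
      rw [hι fun i => ell F (F xs) (xs i)]
      simp only [ell, hB, Finset.prod_mul_distrib, Finset.prod_const, Finset.card_univ,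
        Fintype.card_fin, hpown]
      rw [← hι, hunit]
end
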